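/- Let A be a Hermitian n×n matrix over the split quaternion algebra H, and let A' be the matrix obtained from A by adding to its i-th row a left linear combination of other rows of A, i.e., the new i-th row is a_{i.} + c_1·a_{i₁.} + ⋯ + c_k·a_{i_k.} with c_1,…,c_k ∈ H and indices i₁,…,i_k all different from i. Then rdet_i A' = cdet_i A' = det A. -/

import Mathlib

/-- The split quaternion (coquaternion) algebra over ℝ:
`i² = −1`, `j² = 1`, `k² = 1`, `ij = −ji = k`. -/
abbrev SplitQuaternion : Type := QuaternionAlgebra ℝ (-1) 0 1

noncomputable section

namespace SplitQuaternion

variable {n : ℕ}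

/-- The ordered product of entries of `A` along the cycle of `σ` containing `s`,
read in the "row" direction:
`a_{s, σ s} * a_{σ s, σ² s} * ⋯ * a_{σ^{L−1} s, s}` where `L` is the cycle length. -/
def rowCycleProd (A : Matrix (Fin n) (Fin n) SplitQuaternion) (σ : Equiv.Perm (Fin n))
    (s : Fin n) : SplitQuaternion :=
  ((List.range (Function.minimalPeriod σ s)).map
    (fun m => A ((σ ^ m) s) ((σ ^ (m + 1)) s))).prod

/-- The ordered product of entries of `A` along the cycle of `σ` containing `s`,
read in the "column" direction:
`a_{s, σ^{L−1} s} * ⋯ * a_{σ² s, σ s} * a_{σ s, s}` where `L` is the cycle length. -/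
def colCycleProd (A : Matrix (Fin n) (Fin n) SplitQuaternion) (σ : Equiv.Perm (Fin n))
    (s : Fin n) : SplitQuaternion :=
  (((List.range (Function.minimalPeriod σ s)).map
    (fun m => A ((σ ^ (m + 1)) s) ((σ ^ m) s))).reverse).prod

open scoped Classical in
/-- The least elements of the cycles of `σ` other than the cycle containing `i`,
listed in increasing order. -/
def otherCycleMins (σ : Equiv.Perm (Fin n)) (i : Fin n) : List (Fin n) :=
  (Finset.univ.filter (fun s : Fin n =>
    (∀ t, σ.SameCycle s t → s ≤ t) ∧ ¬ σ.SameCycle i s)).sort (· ≤ ·)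

/-- The `i`-th row determinant of `A`: the sum over all permutations `σ` of
`(−1)^{n−r}` (which is `sign σ`, `r` being the number of disjoint cycles of `σ`,
fixed points included) times the product of the entries of `A` ordered according to
the left-ordered cycle notation of `σ` whose first cycle starts with `i`, every
other cycle starting with its least element, the cycles being ordered by
increasing least elements. -/
def rdet (A : Matrix (Fin n) (Fin n) SplitQuaternion) (i : Fin n) : SplitQuaternion :=
  ∑ σ : Equiv.Perm (Fin n),
    ((Equiv.Perm.sign σ : ℤ) : SplitQuaternion) *
      (rowCycleProd A σ i * ((otherCycleMins σ i).map (rowCycleProd A σ)).prod)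

/-- The `j`-th column determinant of `A`: the sum over all permutations `τ` of
`(−1)^{n−r}` times the product of the entries of `A` ordered according to the
right-ordered cycle notation of `τ` whose rightmost cycle ends with `j`, every
other cycle ending with its least element, the cycles being ordered (from right
to left) by increasing least elements. -/
def cdet (A : Matrix (Fin n) (Fin n) SplitQuaternion) (j : Fin n) : SplitQuaternion :=
  ∑ σ : Equiv.Perm (Fin n),
    ((Equiv.Perm.sign σ : ℤ) : SplitQuaternion) *
      ((((otherCycleMins σ j).reverse).map (colCycleProd A σ)).prod * colCycleProd A σ j)

/-- The determinant of a Hermitian matrix: the common value of all row and column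
determinants (here given as `rdet` at the index `0`). -/
def hdet [NeZero n] (A : Matrix (Fin n) (Fin n) SplitQuaternion) : SplitQuaternion :=
  rdet A 0


lemma add_star_eq_two_smul_re (x : SplitQuaternion) :
    x + star x = (2 : ℝ) • algebraMap ℝ SplitQuaternion x.re := by
  ext <;> simp [two_mul]

lemma re_mul_comm (x y : SplitQuaternion) : (x * y).re = (y * x).re := by
  simp; ring

lemma star_list_prod (l : List SplitQuaternion) :
    star l.prod = (l.map star).reverse.prod := by
  induction l with
  | nil => simp
  | cons a l ih => simp [ih]

lemma isPeriodicPt_perm_iff (σ : Equiv.Perm (Fin n)) (k : ℕ) (s : Fin n) :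
    Function.IsPeriodicPt σ k s ↔ (σ ^ k) s = s := by
  rw [Function.IsPeriodicPt, Function.IsFixedPt, Equiv.Perm.iterate_eq_pow]

lemma pow_minimalPeriod_apply (σ : Equiv.Perm (Fin n)) (s : Fin n) :
    (σ ^ Function.minimalPeriod σ s) s = s :=
  (isPeriodicPt_perm_iff _ _ _).1 (Function.isPeriodicPt_minimalPeriod _ _)

lemma minimalPeriod_perm_pos (σ : Equiv.Perm (Fin n)) (s : Fin n) :
    0 < Function.minimalPeriod σ s :=
  Function.IsPeriodicPt.minimalPeriod_pos (orderOf_pos σ)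
    ((isPeriodicPt_perm_iff _ _ _).2 (by simp [pow_orderOf_eq_one]))

lemma rowCycleProd_congr {A B : Matrix (Fin n) (Fin n) SplitQuaternion}
    {σ τ : Equiv.Perm (Fin n)} {s : Fin n} (h : ∀ m : ℕ, (σ ^ m) s = (τ ^ m) s)
    (hAB : ∀ (m : ℕ) q, A ((σ ^ m) s) q = B ((σ ^ m) s) q) :
    rowCycleProd A σ s = rowCycleProd B τ s := by
  have hp : Function.minimalPeriod σ s = Function.minimalPeriod τ s := by
    rw [Function.minimalPeriod_eq_minimalPeriod_iff]
    intro m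
    rw [isPeriodicPt_perm_iff, isPeriodicPt_perm_iff, h]
  rw [rowCycleProd, rowCycleProd, hp]
  simp only [← h, hAB]

lemma minimalPeriod_perm_inv (σ : Equiv.Perm (Fin n)) (s : Fin n) :
    Function.minimalPeriod (σ⁻¹ : Equiv.Perm (Fin n)) s = Function.minimalPeriod σ s := by
  rw [Function.minimalPeriod_eq_minimalPeriod_iff]
  intro m
  rw [isPeriodicPt_perm_iff, isPeriodicPt_perm_iff, inv_pow, Equiv.Perm.inv_eq_iff_eq, eq_comm]

lemma colCycleProd_eq_rowCycleProd_inv (A : Matrix (Fin n) (Fin n) SplitQuaternion)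
    (σ : Equiv.Perm (Fin n)) (s : Fin n) :
    colCycleProd A σ s = rowCycleProd A σ⁻¹ s := by
  have key : ∀ a b : ℕ, a + b = Function.minimalPeriod σ s → (σ⁻¹ ^ a) s = (σ ^ b) s := by
    intro a b hab
    rw [inv_pow, Equiv.Perm.inv_eq_iff_eq, ← Equiv.Perm.mul_apply, ← pow_add, hab,
      pow_minimalPeriod_apply]
  rw [colCycleProd, rowCycleProd, minimalPeriod_perm_inv]
  congr 1
  apply List.ext_getElem
  · simp
  · intro m h₁ h₂
    simp only [List.length_map, List.length_range] at h₂
    simp only [List.getElem_reverse, List.getElem_map, List.getElem_range, List.length_map,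
      List.length_range]
    rw [key m (Function.minimalPeriod σ s - 1 - m + 1) (by omega),
      key (m + 1) (Function.minimalPeriod σ s - 1 - m) (by omega)]

lemma star_rowCycleProd {A : Matrix (Fin n) (Fin n) SplitQuaternion} (hA : A.IsHermitian)
    (σ : Equiv.Perm (Fin n)) (s : Fin n) :
    star (rowCycleProd A σ s) = rowCycleProd A σ⁻¹ s := by
  rw [← colCycleProd_eq_rowCycleProd_inv, rowCycleProd, colCycleProd, star_list_prod,
    List.map_map]
  congr 3
  funext m
  exact hA.apply _ _

lemma re_rowCycleProd_inv {A : Matrix (Fin n) (Fin n) SplitQuaternion} (hA : A.IsHermitian)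
    (σ : Equiv.Perm (Fin n)) (s : Fin n) :
    (rowCycleProd A σ⁻¹ s).re = (rowCycleProd A σ s).re := by
  rw [← star_rowCycleProd hA]
  simp

lemma minimalPeriod_apply_perm (σ : Equiv.Perm (Fin n)) (s : Fin n) :
    Function.minimalPeriod σ (σ s) = Function.minimalPeriod σ s := by
  rw [Function.minimalPeriod_eq_minimalPeriod_iff]
  intro m
  rw [isPeriodicPt_perm_iff, isPeriodicPt_perm_iff, ← Equiv.Perm.mul_apply, ← pow_succ, pow_succ',
    Equiv.Perm.mul_apply, EmbeddingLike.apply_eq_iff_eq]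

lemma re_rowCycleProd_apply (A : Matrix (Fin n) (Fin n) SplitQuaternion)
    (σ : Equiv.Perm (Fin n)) (s : Fin n) :
    (rowCycleProd A σ (σ s)).re = (rowCycleProd A σ s).re := by
  rw [rowCycleProd, rowCycleProd, minimalPeriod_apply_perm]
  obtain ⟨L, hL⟩ := Nat.exists_eq_succ_of_ne_zero (minimalPeriod_perm_pos σ s).ne'
  have hs : (σ ^ (L + 1)) s = s := by
    rw [← Nat.succ_eq_add_one, ← hL, pow_minimalPeriod_apply]
  have hc : ∀ m : ℕ, (σ ^ m) (σ s) = (σ ^ (m + 1)) s := fun m => by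
    rw [pow_succ, Equiv.Perm.mul_apply]
  rw [hL, Nat.succ_eq_add_one]
  conv_rhs => rw [List.range_succ_eq_map]
  rw [List.range_succ]
  simp only [hc, List.map_append, List.prod_append, List.map_cons, List.map_nil, List.prod_cons,
    List.prod_nil, List.map_map, mul_one]
  rw [re_mul_comm, hs, pow_succ' σ (L + 1), Equiv.Perm.mul_apply, hs]
  simp [Function.comp_def]

lemma re_rowCycleProd_of_sameCycle (A : Matrix (Fin n) (Fin n) SplitQuaternion)
    {σ : Equiv.Perm (Fin n)} {s t : Fin n} (h : σ.SameCycle s t) :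
    (rowCycleProd A σ t).re = (rowCycleProd A σ s).re := by
  obtain ⟨k, rfl⟩ := h.exists_nat_pow_eq
  induction k with
  | zero => simp
  | succ k ih =>
    rw [pow_succ', Equiv.Perm.mul_apply, re_rowCycleProd_apply]
    exact ih (Equiv.Perm.sameCycle_pow_right.2 (Equiv.Perm.SameCycle.refl _ _))

section Flip

open scoped Classical in
/-- The permutation obtained from `σ` by inverting the cycle through `s`. -/
def flipCycle (s : Fin n) (σ : Equiv.Perm (Fin n)) : Equiv.Perm (Fin n) :=
  σ * (σ.cycleOf s)⁻¹ * (σ.cycleOf s)⁻¹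

lemma flipCycle_apply_of_sameCycle {s x : Fin n} {σ : Equiv.Perm (Fin n)}
    (h : σ.SameCycle s x) : flipCycle s σ x = σ⁻¹ x := by
  classical
  have h₁ : σ.SameCycle s (σ⁻¹ x) := Equiv.Perm.sameCycle_symm_apply_right.2 h
  have h₂ : σ.SameCycle s (σ⁻¹ (σ⁻¹ x)) := Equiv.Perm.sameCycle_symm_apply_right.2 h₁
  have e₁ : (σ.cycleOf s)⁻¹ x = σ⁻¹ x := by
    rw [Equiv.Perm.inv_eq_iff_eq, h₁.cycleOf_apply]; simp
  have e₂ : (σ.cycleOf s)⁻¹ (σ⁻¹ x) = σ⁻¹ (σ⁻¹ x) := by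
    rw [Equiv.Perm.inv_eq_iff_eq, h₂.cycleOf_apply]; simp
  have : flipCycle s σ x = σ ((σ.cycleOf s)⁻¹ ((σ.cycleOf s)⁻¹ x)) := by
    unfold flipCycle
    simp only [Equiv.Perm.mul_apply]
  rw [this, e₁, e₂]
  simp

lemma flipCycle_apply_of_not_sameCycle {s x : Fin n} {σ : Equiv.Perm (Fin n)}
    (h : ¬ σ.SameCycle s x) : flipCycle s σ x = σ x := by
  classical
  have e₁ : (σ.cycleOf s)⁻¹ x = x := by
    rw [Equiv.Perm.inv_eq_iff_eq, Equiv.Perm.cycleOf_apply_of_not_sameCycle h]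
  have : flipCycle s σ x = σ ((σ.cycleOf s)⁻¹ ((σ.cycleOf s)⁻¹ x)) := by
    unfold flipCycle
    simp only [Equiv.Perm.mul_apply]
  rw [this, e₁, e₁]

lemma sign_flipCycle (s : Fin n) (σ : Equiv.Perm (Fin n)) :
    Equiv.Perm.sign (flipCycle s σ) = Equiv.Perm.sign σ := by
  rw [flipCycle, map_mul, map_mul, mul_assoc, Int.units_mul_self, mul_one]

lemma sameCycle_of_forall_apply {σ τ : Equiv.Perm (Fin n)} (h : ∀ x, τ.SameCycle x (σ x))
    {x y : Fin n} (hxy : σ.SameCycle x y) : τ.SameCycle x y := by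
  obtain ⟨k, rfl⟩ := hxy.exists_nat_pow_eq
  clear hxy
  induction k with
  | zero => exact Equiv.Perm.SameCycle.refl _ _
  | succ k ih =>
    rw [pow_succ', Equiv.Perm.mul_apply]
    exact ih.trans (h _)

lemma sameCycle_apply_self (σ : Equiv.Perm (Fin n)) (x : Fin n) : σ.SameCycle x (σ x) :=
  Equiv.Perm.sameCycle_apply_right.2 (Equiv.Perm.SameCycle.refl _ _)

lemma sameCycle_flipCycle {s x y : Fin n} {σ : Equiv.Perm (Fin n)} :
    (flipCycle s σ).SameCycle x y ↔ σ.SameCycle x y := by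
  constructor
  · apply sameCycle_of_forall_apply
    intro x
    by_cases h : σ.SameCycle s x
    · rw [flipCycle_apply_of_sameCycle h]
      exact Equiv.Perm.sameCycle_symm_apply_right.2 (Equiv.Perm.SameCycle.refl _ _)
    · rw [flipCycle_apply_of_not_sameCycle h]
      exact sameCycle_apply_self _ _
  · apply sameCycle_of_forall_apply
    intro x
    by_cases h : σ.SameCycle s x
    · have : flipCycle s σ (σ x) = x := by
        rw [flipCycle_apply_of_sameCycle (Equiv.Perm.sameCycle_apply_right.2 h)]
        simp
      conv_lhs => rw [← this]
      exact (sameCycle_apply_self _ _).symm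
    · rw [← flipCycle_apply_of_not_sameCycle h]
      exact sameCycle_apply_self _ _

lemma flipCycle_involutive (s : Fin n) : Function.Involutive (flipCycle s) := by
  intro σ
  ext1 x
  by_cases h : σ.SameCycle s x
  · rw [flipCycle_apply_of_sameCycle (sameCycle_flipCycle.2 h), Equiv.Perm.inv_eq_iff_eq,
      flipCycle_apply_of_sameCycle (Equiv.Perm.sameCycle_apply_right.2 h)]
    simp
  · rw [flipCycle_apply_of_not_sameCycle (mt sameCycle_flipCycle.1 h),
      flipCycle_apply_of_not_sameCycle h]

lemma flipCycle_pow_apply_of_sameCycle {s x : Fin n} {σ : Equiv.Perm (Fin n)}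
    (h : σ.SameCycle s x) (m : ℕ) : (flipCycle s σ ^ m) x = (σ⁻¹ ^ m) x := by
  induction m with
  | zero => simp
  | succ m ih =>
    rw [pow_succ', Equiv.Perm.mul_apply, ih, flipCycle_apply_of_sameCycle, pow_succ',
      Equiv.Perm.mul_apply]
    exact h.trans (Equiv.Perm.sameCycle_inv.1
      (Equiv.Perm.sameCycle_pow_right.2 (Equiv.Perm.SameCycle.refl _ _)))

lemma flipCycle_pow_apply_of_not_sameCycle {s x : Fin n} {σ : Equiv.Perm (Fin n)}
    (h : ¬ σ.SameCycle s x) (m : ℕ) : (flipCycle s σ ^ m) x = (σ ^ m) x := by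
  induction m with
  | zero => simp
  | succ m ih =>
    rw [pow_succ', Equiv.Perm.mul_apply, ih, flipCycle_apply_of_not_sameCycle, pow_succ',
      Equiv.Perm.mul_apply]
    rwa [Equiv.Perm.sameCycle_pow_right]

lemma rowCycleProd_flipCycle_of_sameCycle {A : Matrix (Fin n) (Fin n) SplitQuaternion}
    (hA : A.IsHermitian) {s x : Fin n} {σ : Equiv.Perm (Fin n)} (h : σ.SameCycle s x) :
    rowCycleProd A (flipCycle s σ) x = star (rowCycleProd A σ x) := by
  rw [star_rowCycleProd hA]
  exact rowCycleProd_congr (flipCycle_pow_apply_of_sameCycle h) fun _ _ => rfl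

lemma rowCycleProd_flipCycle_of_not_sameCycle (A : Matrix (Fin n) (Fin n) SplitQuaternion)
    {s x : Fin n} {σ : Equiv.Perm (Fin n)} (h : ¬ σ.SameCycle s x) :
    rowCycleProd A (flipCycle s σ) x = rowCycleProd A σ x :=
  rowCycleProd_congr (flipCycle_pow_apply_of_not_sameCycle h) fun _ _ => rfl

lemma re_rowCycleProd_flipCycle {A : Matrix (Fin n) (Fin n) SplitQuaternion}
    (hA : A.IsHermitian) (s x : Fin n) (σ : Equiv.Perm (Fin n)) :
    (rowCycleProd A (flipCycle s σ) x).re = (rowCycleProd A σ x).re := by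
  by_cases h : σ.SameCycle s x
  · rw [rowCycleProd_flipCycle_of_sameCycle hA h]; simp
  · rw [rowCycleProd_flipCycle_of_not_sameCycle A h]

lemma otherCycleMins_congr {σ τ : Equiv.Perm (Fin n)}
    (h : ∀ x y, τ.SameCycle x y ↔ σ.SameCycle x y) (i : Fin n) :
    otherCycleMins τ i = otherCycleMins σ i := by
  simp only [otherCycleMins, h]

end Flip

lemma sum_eq_of_involutive_of_add_eq {α : Type*} [Fintype α] {φ : α → α}
    (hφ : Function.Involutive φ) {F G : α → SplitQuaternion}
    (h : ∀ σ, F σ + F (φ σ) = (2 : ℝ) • G σ) : ∑ σ, F σ = ∑ σ, G σ := by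
  have h₁ : ∑ σ, F (φ σ) = ∑ σ, F σ := hφ.bijective.sum_comp F
  have h₂ : (2 : ℝ) • ∑ σ, F σ = (2 : ℝ) • ∑ σ, G σ := by
    rw [Finset.smul_sum (f := G), ← Finset.sum_congr rfl fun σ _ => h σ, Finset.sum_add_distrib,
      h₁, two_smul]
  exact smul_right_injective _ (two_ne_zero : (2 : ℝ) ≠ 0) h₂

lemma list_prod_map_add_of_eq_off {α : Type*} {l : List α} (hl : l.Nodup) {a : α} (ha : a ∈ l)
    {f g h : α → SplitQuaternion} (hf : ∀ x ∈ l, x ≠ a → f x = h x)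
    (hg : ∀ x ∈ l, x ≠ a → g x = h x) (hs : f a + g a = (2 : ℝ) • h a) :
    (l.map f).prod + (l.map g).prod = (2 : ℝ) • (l.map h).prod := by
  induction l with
  | nil => simp at ha
  | cons b l ih =>
    rw [List.nodup_cons] at hl
    simp only [List.map_cons, List.prod_cons]
    by_cases hb : b = a
    · subst hb
      have e₁ : l.map f = l.map h := List.map_congr_left fun x hx =>
        hf x (List.mem_cons_of_mem _ hx) (ne_of_mem_of_not_mem hx hl.1)
      have e₂ : l.map g = l.map h := List.map_congr_left fun x hx =>
        hg x (List.mem_cons_of_mem _ hx) (ne_of_mem_of_not_mem hx hl.1)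
      rw [e₁, e₂, ← add_mul, hs, smul_mul_assoc]
    · rw [hf b List.mem_cons_self hb, hg b List.mem_cons_self hb, ← mul_add,
        ih hl.2 ((List.mem_cons.1 ha).resolve_left (Ne.symm hb))
          (fun x hx => hf x (List.mem_cons_of_mem _ hx))
          (fun x hx => hg x (List.mem_cons_of_mem _ hx)), mul_smul_comm]

lemma mem_otherCycleMins {σ : Equiv.Perm (Fin n)} {i s : Fin n} :
    s ∈ otherCycleMins σ i ↔ (∀ t, σ.SameCycle s t → s ≤ t) ∧ ¬ σ.SameCycle i s := by
  simp [otherCycleMins]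

lemma nodup_otherCycleMins (σ : Equiv.Perm (Fin n)) (i : Fin n) : (otherCycleMins σ i).Nodup :=
  Finset.sort_nodup _ _

lemma otherCycleMins_flipCycle (s : Fin n) (σ : Equiv.Perm (Fin n)) (i : Fin n) :
    otherCycleMins (flipCycle s σ) i = otherCycleMins σ i :=
  otherCycleMins_congr (fun _ _ => sameCycle_flipCycle) i

/-- The cycle product of `A` based at `s`, replaced by its real part when `s < k`. -/
def partialReCycleProd (A : Matrix (Fin n) (Fin n) SplitQuaternion) (k : ℕ)
    (σ : Equiv.Perm (Fin n)) (s : Fin n) : SplitQuaternion :=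
  if (s : ℕ) < k then algebraMap ℝ SplitQuaternion (rowCycleProd A σ s).re else rowCycleProd A σ s

lemma partialReCycleProd_succ_of_ne (A : Matrix (Fin n) (Fin n) SplitQuaternion)
    (σ : Equiv.Perm (Fin n)) {s t : Fin n} (h : s ≠ t) :
    partialReCycleProd A (t + 1) σ s = partialReCycleProd A t σ s := by
  have : (s : ℕ) ≠ t := fun e => h (Fin.ext e)
  unfold partialReCycleProd
  congr 1
  exact propext (by omega)

/-- The product of the real parts of the cycle products of `A` over the cycles of `σ` that
do not contain `i`. -/
def otherCyclesRe (A : Matrix (Fin n) (Fin n) SplitQuaternion) (i : Fin n)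
    (σ : Equiv.Perm (Fin n)) : ℝ :=
  ((otherCycleMins σ i).map fun s => (rowCycleProd A σ s).re).prod

lemma sum_partialReCycleProd_succ {A : Matrix (Fin n) (Fin n) SplitQuaternion}
    (hA : A.IsHermitian) (i : Fin n) {q : Equiv.Perm (Fin n) → SplitQuaternion}
    (hq : ∀ s σ, ¬ σ.SameCycle i s → q (flipCycle s σ) = q σ) (k : Fin n) :
    ∑ σ : Equiv.Perm (Fin n), ((Equiv.Perm.sign σ : ℤ) : SplitQuaternion) *
        (q σ * ((otherCycleMins σ i).map (partialReCycleProd A k σ)).prod) =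
      ∑ σ : Equiv.Perm (Fin n), ((Equiv.Perm.sign σ : ℤ) : SplitQuaternion) *
        (q σ * ((otherCycleMins σ i).map (partialReCycleProd A (k + 1) σ)).prod) := by
  classical
  refine sum_eq_of_involutive_of_add_eq
    (φ := fun σ => if k ∈ otherCycleMins σ i then flipCycle k σ else σ) ?_ ?_
  · intro σ
    by_cases hk : k ∈ otherCycleMins σ i
    · simp only [hk, if_true, otherCycleMins_flipCycle, flipCycle_involutive k σ]
    · simp only [hk, if_false]
  · intro σ
    by_cases hk : k ∈ otherCycleMins σ i
    · simp only [hk, if_true, otherCycleMins_flipCycle, sign_flipCycle]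
      rw [hq k σ (mem_otherCycleMins.1 hk).2, ← mul_add, ← mul_add,
        list_prod_map_add_of_eq_off (nodup_otherCycleMins σ i) hk
          (h := partialReCycleProd A (k + 1) σ), mul_smul_comm, mul_smul_comm]
      · intro x _ hx
        exact (partialReCycleProd_succ_of_ne A σ hx).symm
      · intro x hx hxk
        have hc : ¬ σ.SameCycle k x := fun hc => hxk <| le_antisymm
          ((mem_otherCycleMins.1 hx).1 k hc.symm) ((mem_otherCycleMins.1 hk).1 x hc)
        rw [partialReCycleProd_succ_of_ne A σ hxk, partialReCycleProd, partialReCycleProd,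
          rowCycleProd_flipCycle_of_not_sameCycle A hc]
      · simp only [partialReCycleProd, lt_irrefl, if_false, Nat.lt_succ_self, if_true]
        rw [rowCycleProd_flipCycle_of_sameCycle hA (Equiv.Perm.SameCycle.refl _ _),
          add_star_eq_two_smul_re]
    · simp only [hk, if_false]
      rw [two_smul]
      have : (otherCycleMins σ i).map (partialReCycleProd A (k + 1) σ) =
          (otherCycleMins σ i).map (partialReCycleProd A k σ) := List.map_congr_left fun x hx =>
        partialReCycleProd_succ_of_ne A σ (ne_of_mem_of_not_mem hx hk)
      rw [this]

lemma sum_eq_sum_otherCyclesRe_smul {A : Matrix (Fin n) (Fin n) SplitQuaternion}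
    (hA : A.IsHermitian) (i : Fin n) {q : Equiv.Perm (Fin n) → SplitQuaternion}
    (hq : ∀ s σ, ¬ σ.SameCycle i s → q (flipCycle s σ) = q σ) :
    ∑ σ : Equiv.Perm (Fin n), ((Equiv.Perm.sign σ : ℤ) : SplitQuaternion) *
        (q σ * ((otherCycleMins σ i).map (rowCycleProd A σ)).prod) =
      ∑ σ : Equiv.Perm (Fin n), (((Equiv.Perm.sign σ : ℤ) : ℝ) * otherCyclesRe A i σ) • q σ := by
  have key : ∀ k ≤ n,
      ∑ σ : Equiv.Perm (Fin n), ((Equiv.Perm.sign σ : ℤ) : SplitQuaternion) *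
        (q σ * ((otherCycleMins σ i).map (rowCycleProd A σ)).prod) =
      ∑ σ : Equiv.Perm (Fin n), ((Equiv.Perm.sign σ : ℤ) : SplitQuaternion) *
        (q σ * ((otherCycleMins σ i).map (partialReCycleProd A k σ)).prod) := by
    intro k
    induction k with
    | zero =>
      intro _
      have : ∀ σ, partialReCycleProd A 0 σ = rowCycleProd A σ := fun σ => by
        funext s; simp [partialReCycleProd]
      simp only [this]
    | succ k ih =>
      intro hk
      rw [ih (by omega)]
      exact sum_partialReCycleProd_succ hA i hq ⟨k, hk⟩
  rw [key n le_rfl]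
  refine Finset.sum_congr rfl fun σ _ => ?_
  have : partialReCycleProd A n σ =
      algebraMap ℝ SplitQuaternion ∘ fun s => (rowCycleProd A σ s).re := by
    funext s; simp [partialReCycleProd]
  rw [this, ← List.map_map, ← map_list_prod, ← Algebra.commutes, ← Algebra.smul_def, mul_smul,
    otherCyclesRe, Int.cast_smul_eq_zsmul, zsmul_eq_mul]

lemma rowCycleProd_of_off_row {A B : Matrix (Fin n) (Fin n) SplitQuaternion} {i : Fin n}
    (hB : ∀ p q, p ≠ i → B p q = A p q) {σ : Equiv.Perm (Fin n)} {s : Fin n}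
    (hs : ¬ σ.SameCycle i s) : rowCycleProd B σ s = rowCycleProd A σ s := by
  refine rowCycleProd_congr (fun _ => rfl) fun m q => hB _ _ ?_
  intro h
  exact hs (h ▸ Equiv.Perm.sameCycle_pow_left.2 (Equiv.Perm.SameCycle.refl _ _))

lemma rdet_eq_sum_smul {A B : Matrix (Fin n) (Fin n) SplitQuaternion} (hA : A.IsHermitian)
    {i : Fin n} (hB : ∀ p q, p ≠ i → B p q = A p q) :
    rdet B i = ∑ σ : Equiv.Perm (Fin n),
      (((Equiv.Perm.sign σ : ℤ) : ℝ) * otherCyclesRe A i σ) • rowCycleProd B σ i := by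
  rw [← sum_eq_sum_otherCyclesRe_smul hA i
    fun s σ h => rowCycleProd_flipCycle_of_not_sameCycle B fun h' => h h'.symm]
  refine Finset.sum_congr rfl fun σ _ => ?_
  rw [List.map_congr_left fun s hs => rowCycleProd_of_off_row hB (mem_otherCycleMins.1 hs).2]

lemma otherCyclesRe_inv {A : Matrix (Fin n) (Fin n) SplitQuaternion} (hA : A.IsHermitian)
    (i : Fin n) (σ : Equiv.Perm (Fin n)) : otherCyclesRe A i σ⁻¹ = otherCyclesRe A i σ := by
  simp only [otherCyclesRe, re_rowCycleProd_inv hA,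
    otherCycleMins_congr (fun _ _ => Equiv.Perm.sameCycle_inv (f := σ)) i]

lemma cdet_eq_rdet {A B : Matrix (Fin n) (Fin n) SplitQuaternion} (hA : A.IsHermitian)
    {i : Fin n} (hB : ∀ p q, p ≠ i → B p q = A p q) : cdet B i = rdet B i := by
  have h : star (cdet B i) = ∑ σ : Equiv.Perm (Fin n),
      (((Equiv.Perm.sign σ : ℤ) : ℝ) * otherCyclesRe A i σ) • star (colCycleProd B σ i) := by
    rw [← sum_eq_sum_otherCyclesRe_smul hA i, cdet, star_sum]
    · refine Finset.sum_congr rfl fun σ _ => ?_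
      rw [star_mul, star_mul, star_intCast, star_list_prod, ← List.map_reverse,
        ← List.map_reverse, List.reverse_reverse, List.map_map, (Int.cast_commute _ _).eq]
      congr 3
      refine List.map_congr_left fun s hs => ?_
      have hs' : ¬ (σ⁻¹).SameCycle i s :=
        mt Equiv.Perm.sameCycle_inv.1 (mem_otherCycleMins.1 hs).2
      rw [Function.comp_apply, colCycleProd_eq_rowCycleProd_inv, rowCycleProd_of_off_row hB hs',
        star_rowCycleProd hA, inv_inv]
    · intro s σ h
      have h' : ¬ σ.SameCycle s i := fun h' => h h'.symm
      rw [colCycleProd_eq_rowCycleProd_inv, colCycleProd_eq_rowCycleProd_inv]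
      congr 1
      refine rowCycleProd_congr (fun m => ?_) fun _ _ => rfl
      rw [inv_pow, inv_pow, Equiv.Perm.inv_eq_iff_eq, flipCycle_pow_apply_of_not_sameCycle]
      · simp
      · rw [← inv_pow]
        exact fun e => h' (e.trans (Equiv.Perm.sameCycle_inv.1
          (Equiv.Perm.sameCycle_pow_left.2 (Equiv.Perm.SameCycle.refl _ _))))
  rw [rdet_eq_sum_smul hA hB, ← star_star (cdet B i), h, star_sum, ← Equiv.sum_comp (Equiv.inv _)]
  refine Finset.sum_congr rfl fun σ _ => ?_
  simp only [Equiv.inv_apply, Equiv.Perm.sign_inv, otherCyclesRe_inv hA,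
    colCycleProd_eq_rowCycleProd_inv, inv_inv, QuaternionAlgebra.star_smul, star_star]

open scoped Classical in
/-- The real part of the cycle product of `A` based at `s` if `s` is the least element of its
cycle in `σ`, and `1` otherwise. -/
def cycleRe (A : Matrix (Fin n) (Fin n) SplitQuaternion) (σ : Equiv.Perm (Fin n))
    (s : Fin n) : ℝ :=
  if ∀ t, σ.SameCycle s t → s ≤ t then (rowCycleProd A σ s).re else 1

lemma cycleRe_flipCycle {A : Matrix (Fin n) (Fin n) SplitQuaternion} (hA : A.IsHermitian)
    (j s : Fin n) (σ : Equiv.Perm (Fin n)) :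
    cycleRe A (flipCycle j σ) s = cycleRe A σ s := by
  simp only [cycleRe, sameCycle_flipCycle, re_rowCycleProd_flipCycle hA]

lemma cycleRe_congr {A : Matrix (Fin n) (Fin n) SplitQuaternion} {σ τ : Equiv.Perm (Fin n)}
    {s : Fin n} (h : ∀ m : ℕ, (σ ^ m) s = (τ ^ m) s)
    (hc : ∀ t, σ.SameCycle s t ↔ τ.SameCycle s t) : cycleRe A σ s = cycleRe A τ s := by
  simp only [cycleRe, hc, rowCycleProd_congr (A := A) (B := A) h fun _ _ => rfl]

open scoped Classical in
lemma otherCyclesRe_eq_prod_cycleRe (A : Matrix (Fin n) (Fin n) SplitQuaternion) (i : Fin n)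
    (σ : Equiv.Perm (Fin n)) :
    otherCyclesRe A i σ = ∏ s with ¬ σ.SameCycle i s, cycleRe A σ s := by
  simp only [cycleRe]
  rw [← Finset.prod_filter, Finset.filter_filter, otherCyclesRe,
    ← List.prod_toFinset _ (nodup_otherCycleMins σ i)]
  refine Finset.prod_congr ?_ fun _ _ => rfl
  ext s
  simp [mem_otherCycleMins, and_comm]

open scoped Classical in
lemma prod_cycleRe_sameCycle (A : Matrix (Fin n) (Fin n) SplitQuaternion) (j : Fin n)
    (σ : Equiv.Perm (Fin n)) :
    ∏ s with σ.SameCycle j s, cycleRe A σ s = (rowCycleProd A σ j).re := by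
  have hne : (Finset.univ.filter fun s => σ.SameCycle j s).Nonempty :=
    ⟨j, by simp [Equiv.Perm.SameCycle.refl]⟩
  obtain ⟨a, ha, hmin⟩ := Finset.exists_min_image _ id hne
  simp only [Finset.mem_filter, Finset.mem_univ, true_and, id] at ha hmin
  rw [Finset.prod_eq_single a]
  · rw [cycleRe, if_pos fun t ht => hmin t (ha.trans ht), re_rowCycleProd_of_sameCycle A ha]
  · intro b hb hba
    rw [Finset.mem_filter] at hb
    exact if_neg fun h =>
      hba (le_antisymm (h a (hb.2.symm.trans ha)) (hmin b hb.2))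
  · simp [ha]

/-- The real-valued determinant attached to `A`, in which every cycle product is replaced by its
real part. -/
def reDet (A : Matrix (Fin n) (Fin n) SplitQuaternion) : ℝ :=
  ∑ σ : Equiv.Perm (Fin n), ((Equiv.Perm.sign σ : ℤ) : ℝ) * ∏ s, cycleRe A σ s

lemma otherCyclesRe_flipCycle {A : Matrix (Fin n) (Fin n) SplitQuaternion} (hA : A.IsHermitian)
    (i j : Fin n) (σ : Equiv.Perm (Fin n)) :
    otherCyclesRe A i (flipCycle j σ) = otherCyclesRe A i σ := by
  simp only [otherCyclesRe, otherCycleMins_flipCycle, re_rowCycleProd_flipCycle hA]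

lemma rdet_eq_reDet {A : Matrix (Fin n) (Fin n) SplitQuaternion} (hA : A.IsHermitian)
    (i : Fin n) : rdet A i = algebraMap ℝ SplitQuaternion (reDet A) := by
  classical
  rw [rdet_eq_sum_smul hA fun _ _ _ => rfl, reDet, map_sum]
  refine sum_eq_of_involutive_of_add_eq (flipCycle_involutive i) fun σ => ?_
  rw [sign_flipCycle, otherCyclesRe_flipCycle hA,
    rowCycleProd_flipCycle_of_sameCycle hA (Equiv.Perm.SameCycle.refl _ _), ← smul_add,
    add_star_eq_two_smul_re, smul_comm, ← Finset.prod_filter_mul_prod_filter_not Finset.univ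
      (fun s => σ.SameCycle i s), prod_cycleRe_sameCycle, ← otherCyclesRe_eq_prod_cycleRe,
    mul_comm (rowCycleProd A σ i).re, ← mul_assoc, map_mul _ (_ * _), Algebra.smul_def (_ * _)]

lemma hdet_eq_rdet [NeZero n] {A : Matrix (Fin n) (Fin n) SplitQuaternion} (hA : A.IsHermitian)
    (i : Fin n) : hdet A = rdet A i := by
  rw [hdet, rdet_eq_reDet hA, rdet_eq_reDet hA]

section Swap

variable {i j : Fin n} {σ : Equiv.Perm (Fin n)}

lemma mul_swap_apply_of_ne {x : Fin n} (hi : x ≠ i) (hj : x ≠ j) :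
    (σ * Equiv.swap i j) x = σ x := by
  rw [Equiv.Perm.mul_apply, Equiv.swap_apply_of_ne_of_ne hi hj]

lemma mul_swap_pow_apply {a b : Fin n} {L : ℕ} (hab : (σ * Equiv.swap i j) a = σ b)
    (h : ∀ m, 0 < m → m < L → (σ ^ m) b ≠ i ∧ (σ ^ m) b ≠ j) {m : ℕ} (hm : 0 < m)
    (hmL : m ≤ L) : ((σ * Equiv.swap i j) ^ m) a = (σ ^ m) b := by
  induction m with
  | zero => omega
  | succ m ih =>
    rcases Nat.eq_zero_or_pos m with rfl | h₀
    · simpa using hab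
    · obtain ⟨h₁, h₂⟩ := h m h₀ (by omega)
      rw [pow_succ', Equiv.Perm.mul_apply, ih h₀ (by omega), mul_swap_apply_of_ne h₁ h₂,
        pow_succ', Equiv.Perm.mul_apply]

lemma pow_apply_ne_self {s : Fin n} {m : ℕ} (hm : 0 < m) (hlt : m < Function.minimalPeriod σ s) :
    (σ ^ m) s ≠ s := fun h =>
  Function.not_isPeriodicPt_of_pos_of_lt_minimalPeriod hm.ne' hlt ((isPeriodicPt_perm_iff _ _ _).2 h)

lemma pow_apply_ne_of_not_sameCycle {s t : Fin n} (h : ¬ σ.SameCycle s t) (m : ℕ) :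
    (σ ^ m) s ≠ t := fun e =>
  h (e ▸ Equiv.Perm.sameCycle_pow_right.2 (Equiv.Perm.SameCycle.refl _ _))

lemma mul_swap_pow_apply_left (h : ¬ σ.SameCycle i j) {m : ℕ} (hm : 0 < m)
    (hmL : m ≤ Function.minimalPeriod σ j) :
    ((σ * Equiv.swap i j) ^ m) i = (σ ^ m) j :=
  mul_swap_pow_apply (by simp)
    (fun _ h₀ h₁ => ⟨pow_apply_ne_of_not_sameCycle (fun h' => h h'.symm) _,
      pow_apply_ne_self h₀ h₁⟩) hm hmL

lemma mul_swap_pow_apply_right (h : ¬ σ.SameCycle i j) {m : ℕ} (hm : 0 < m)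
    (hmL : m ≤ Function.minimalPeriod σ i) :
    ((σ * Equiv.swap i j) ^ m) j = (σ ^ m) i :=
  mul_swap_pow_apply (by simp)
    (fun _ h₀ h₁ => ⟨pow_apply_ne_self h₀ h₁, pow_apply_ne_of_not_sameCycle h _⟩) hm hmL

lemma mul_swap_pow_minimalPeriod (h : ¬ σ.SameCycle i j) :
    ((σ * Equiv.swap i j) ^ Function.minimalPeriod σ j) i = j := by
  rw [mul_swap_pow_apply_left h (minimalPeriod_perm_pos _ _) le_rfl, pow_minimalPeriod_apply]

lemma mul_swap_pow_minimalPeriod_add (h : ¬ σ.SameCycle i j) (m : ℕ) :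
    ((σ * Equiv.swap i j) ^ (Function.minimalPeriod σ j + m)) i =
      ((σ * Equiv.swap i j) ^ m) j := by
  rw [add_comm, pow_add, Equiv.Perm.mul_apply, mul_swap_pow_minimalPeriod h]

lemma sameCycle_mul_swap_of_not_sameCycle (h : ¬ σ.SameCycle i j) :
    (σ * Equiv.swap i j).SameCycle i j := by
  have h' := mul_swap_pow_minimalPeriod h
  conv_rhs => rw [← h']
  exact Equiv.Perm.sameCycle_pow_right.2 (Equiv.Perm.SameCycle.refl _ _)

lemma minimalPeriod_mul_swap (h : ¬ σ.SameCycle i j) :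
    Function.minimalPeriod (σ * Equiv.swap i j : Equiv.Perm (Fin n)) i =
      Function.minimalPeriod σ j + Function.minimalPeriod σ i := by
  have hi := minimalPeriod_perm_pos σ i
  have hj := minimalPeriod_perm_pos σ j
  apply le_antisymm
  · apply Function.IsPeriodicPt.minimalPeriod_le (by omega)
    rw [isPeriodicPt_perm_iff, mul_swap_pow_minimalPeriod_add h,
      mul_swap_pow_apply_right h hi le_rfl, pow_minimalPeriod_apply]
  · by_contra! hlt
    have hpos := minimalPeriod_perm_pos (σ * Equiv.swap i j) i
    have hper := pow_minimalPeriod_apply (σ * Equiv.swap i j) i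
    generalize Function.minimalPeriod (σ * Equiv.swap i j : Equiv.Perm (Fin n)) i = m at *
    rcases le_or_gt m (Function.minimalPeriod σ j) with hm | hm
    · rw [mul_swap_pow_apply_left h hpos hm] at hper
      exact pow_apply_ne_of_not_sameCycle (fun h' => h h'.symm) _ hper
    · obtain ⟨d, rfl⟩ := Nat.exists_eq_add_of_lt hm
      rw [add_assoc, mul_swap_pow_minimalPeriod_add h,
        mul_swap_pow_apply_right h (by omega) (by omega)] at hper
      exact pow_apply_ne_self (by omega) (by omega) hper

lemma rowCycleProd_mul_swap {A B : Matrix (Fin n) (Fin n) SplitQuaternion}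
    (hB : ∀ p q, p ≠ i → B p q = A p q) (hij : i ≠ j) (hBi : ∀ q, B i q = A j q)
    (h : ¬ σ.SameCycle i j) :
    rowCycleProd B (σ * Equiv.swap i j) i = rowCycleProd A σ j * rowCycleProd B σ i := by
  have h' : ¬ σ.SameCycle j i := fun h' => h h'.symm
  rw [rowCycleProd, minimalPeriod_mul_swap h, List.range_add, List.map_append, List.prod_append,
    List.map_map, rowCycleProd, rowCycleProd]
  congr 2
  · refine List.map_congr_left fun m hm => ?_
    rw [List.mem_range] at hm
    rw [mul_swap_pow_apply_left h (Nat.succ_pos m) (by omega)]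
    rcases Nat.eq_zero_or_pos m with rfl | h₀
    · simp [hBi]
    · rw [mul_swap_pow_apply_left h h₀ hm.le, hB _ _ (pow_apply_ne_of_not_sameCycle h' _)]
  · refine List.map_congr_left fun m hm => ?_
    rw [List.mem_range] at hm
    rw [Function.comp_apply, add_assoc, mul_swap_pow_minimalPeriod_add h,
      mul_swap_pow_minimalPeriod_add h, mul_swap_pow_apply_right h (Nat.succ_pos m) (by omega)]
    rcases Nat.eq_zero_or_pos m with rfl | h₀
    · simp [hBi, hB j _ hij.symm]
    · rw [mul_swap_pow_apply_right h h₀ hm.le]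

lemma not_sameCycle_mul_swap_of_sameCycle (hij : i ≠ j) (h : σ.SameCycle i j) :
    ¬ (σ * Equiv.swap i j).SameCycle i j := by
  classical
  have hex : ∃ a : ℕ, (σ ^ a) i = j := h.exists_nat_pow_eq
  obtain ⟨a, ha, hmin⟩ : ∃ a : ℕ, (σ ^ a) i = j ∧ ∀ m < a, (σ ^ m) i ≠ j :=
    ⟨Nat.find hex, Nat.find_spec hex, fun m hm => Nat.find_min hex hm⟩
  have ha₀ : 0 < a := Nat.pos_of_ne_zero fun h₀ => hij (by simpa [h₀] using ha)
  have hmin' : ∀ m, 0 < m → m < a → (σ ^ m) i ≠ i := fun m h₀ hm e => by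
    refine hmin (a - m) (by omega) ?_
    conv_rhs => rw [← ha, ← Nat.sub_add_cancel hm.le, pow_add, Equiv.Perm.mul_apply, e]
  have hpow : ∀ m, 0 < m → m ≤ a → ((σ * Equiv.swap i j) ^ m) j = (σ ^ m) i :=
    fun m h₀ hm => mul_swap_pow_apply (by simp)
      (fun m h₀ hm => ⟨hmin' m h₀ hm, hmin m hm⟩) h₀ hm
  intro hc
  obtain ⟨m, hm⟩ := hc.symm.exists_nat_pow_eq
  have hper : Function.IsPeriodicPt (σ * Equiv.swap i j : Equiv.Perm (Fin n)) a j := by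
    rw [isPeriodicPt_perm_iff, hpow a ha₀ le_rfl, ha]
  rw [← Equiv.Perm.iterate_eq_pow, ← hper.iterate_mod_apply, Equiv.Perm.iterate_eq_pow] at hm
  have hlt := Nat.mod_lt m ha₀
  rcases Nat.eq_zero_or_pos (m % a) with h₀ | h₀
  · rw [h₀] at hm
    exact hij (by simpa using hm.symm)
  · rw [hpow _ h₀ hlt.le] at hm
    exact hmin' _ h₀ hlt hm

lemma mul_swap_pow_apply_of_not_sameCycle {s : Fin n} (hi : ¬ σ.SameCycle i s)
    (hj : ¬ σ.SameCycle j s) (m : ℕ) : ((σ * Equiv.swap i j) ^ m) s = (σ ^ m) s := by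
  induction m with
  | zero => simp
  | succ m ih =>
    rw [pow_succ', Equiv.Perm.mul_apply, ih, mul_swap_apply_of_ne
      (pow_apply_ne_of_not_sameCycle (fun h => hi h.symm) m)
      (pow_apply_ne_of_not_sameCycle (fun h => hj h.symm) m), pow_succ', Equiv.Perm.mul_apply]

lemma sameCycle_mul_swap_iff {s : Fin n} (hi : ¬ σ.SameCycle i s)
    (hj : ¬ σ.SameCycle j s) (t : Fin n) :
    (σ * Equiv.swap i j).SameCycle s t ↔ σ.SameCycle s t := by
  constructor
  · intro h
    obtain ⟨m, rfl⟩ := h.exists_nat_pow_eq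
    rw [mul_swap_pow_apply_of_not_sameCycle hi hj]
    exact Equiv.Perm.sameCycle_pow_right.2 (Equiv.Perm.SameCycle.refl _ _)
  · intro h
    obtain ⟨m, rfl⟩ := h.exists_nat_pow_eq
    rw [← mul_swap_pow_apply_of_not_sameCycle hi hj]
    exact Equiv.Perm.sameCycle_pow_right.2 (Equiv.Perm.SameCycle.refl _ _)

lemma not_sameCycle_mul_swap {s : Fin n} (hi : ¬ σ.SameCycle i s) (hj : ¬ σ.SameCycle j s) :
    ¬ (σ * Equiv.swap i j).SameCycle i s ∧ ¬ (σ * Equiv.swap i j).SameCycle j s :=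
  ⟨fun h => hi ((sameCycle_mul_swap_iff hi hj i).1 h.symm).symm,
    fun h => hj ((sameCycle_mul_swap_iff hi hj j).1 h.symm).symm⟩

open scoped Classical in
lemma prod_cycleRe_mul_swap (A : Matrix (Fin n) (Fin n) SplitQuaternion) (i j : Fin n)
    (σ : Equiv.Perm (Fin n)) :
    ∏ s with ¬ (σ * Equiv.swap i j).SameCycle i s ∧ ¬ (σ * Equiv.swap i j).SameCycle j s,
        cycleRe A (σ * Equiv.swap i j) s =
      ∏ s with ¬ σ.SameCycle i s ∧ ¬ σ.SameCycle j s, cycleRe A σ s := by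
  symm
  refine Finset.prod_congr ?_ fun s hs => ?_
  · ext s
    simp only [Finset.mem_filter, Finset.mem_univ, true_and]
    refine ⟨fun h => not_sameCycle_mul_swap h.1 h.2, fun h => ?_⟩
    have h' := not_sameCycle_mul_swap h.1 h.2
    rwa [mul_assoc, Equiv.swap_mul_self, mul_one] at h'
  · simp only [Finset.mem_filter, Finset.mem_univ, true_and] at hs
    have h' := not_sameCycle_mul_swap hs.1 hs.2
    rw [mul_assoc, Equiv.swap_mul_self, mul_one] at h'
    exact cycleRe_congr (fun m => (mul_swap_pow_apply_of_not_sameCycle h'.1 h'.2 m).symm)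
      fun t => (sameCycle_mul_swap_iff h'.1 h'.2 t).symm

lemma rdet_eq_zero_of_row_eq {A B : Matrix (Fin n) (Fin n) SplitQuaternion}
    (hA : A.IsHermitian) (hB : ∀ p q, p ≠ i → B p q = A p q) (hij : i ≠ j)
    (hBi : ∀ q, B i q = A j q) : rdet B i = 0 := by
  classical
  let u : Equiv.Perm (Fin n) → ℝ := fun σ =>
    ∏ s with ¬ σ.SameCycle i s ∧ ¬ σ.SameCycle j s, cycleRe A σ s
  let v : Equiv.Perm (Fin n) → SplitQuaternion := fun σ =>
    if σ.SameCycle i j then rowCycleProd B σ i else rowCycleProd A σ j * rowCycleProd B σ i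
  have hv : ∀ σ, v (σ * Equiv.swap i j) = v σ := by
    have hv' : ∀ σ : Equiv.Perm (Fin n), ¬ σ.SameCycle i j → v (σ * Equiv.swap i j) = v σ :=
      fun σ h => by
        simp only [v, h, sameCycle_mul_swap_of_not_sameCycle h, if_true, if_false,
          rowCycleProd_mul_swap hB hij hBi h]
    intro σ
    by_cases h : σ.SameCycle i j
    · rw [← hv' _ (not_sameCycle_mul_swap_of_sameCycle hij h), mul_assoc, Equiv.swap_mul_self,
        mul_one]
    · exact hv' σ h
  have hu : ∀ σ, u (σ * Equiv.swap i j) = u σ := prod_cycleRe_mul_swap A i j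
  have hzero : ∑ σ : Equiv.Perm (Fin n), (((Equiv.Perm.sign σ : ℤ) : ℝ) * u σ) • v σ =
      ∑ _σ : Equiv.Perm (Fin n), (0 : SplitQuaternion) := by
    refine sum_eq_of_involutive_of_add_eq (φ := fun σ => σ * Equiv.swap i j) (fun σ => by
      simp [mul_assoc]) fun σ => ?_
    rw [hv, hu, Equiv.Perm.sign_mul, Equiv.Perm.sign_swap hij]
    simp
  rw [Finset.sum_const_zero] at hzero
  rw [rdet_eq_sum_smul hA hB]
  refine Eq.trans (Eq.symm ?_) hzero
  have huo : ∀ σ : Equiv.Perm (Fin n), σ.SameCycle i j → otherCyclesRe A i σ = u σ :=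
    fun σ h => by
      rw [otherCyclesRe_eq_prod_cycleRe]
      refine Finset.prod_congr (Finset.filter_congr fun s _ => ?_) fun _ _ => rfl
      exact ⟨fun hs => ⟨hs, fun hs' => hs (h.trans hs')⟩, And.left⟩
  have huo' : ∀ σ : Equiv.Perm (Fin n), ¬ σ.SameCycle i j →
      otherCyclesRe A i σ = u σ * (rowCycleProd A σ j).re := fun σ h => by
    rw [otherCyclesRe_eq_prod_cycleRe, ← prod_cycleRe_sameCycle,
      ← Finset.prod_filter_mul_prod_filter_not _ (fun s => σ.SameCycle j s), mul_comm,
      Finset.filter_filter, Finset.filter_filter]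
    congr 1
    refine Finset.prod_congr (Finset.filter_congr fun s _ => ?_) fun _ _ => rfl
    exact ⟨And.right, fun hs => ⟨fun hs' => h (hs'.trans hs.symm), hs⟩⟩
  refine sum_eq_of_involutive_of_add_eq
    (φ := fun σ => if σ.SameCycle i j then σ else flipCycle j σ) (fun σ => ?_) fun σ => ?_
  · by_cases h : σ.SameCycle i j
    · simp only [h, if_true]
    · simp only [h, if_false, sameCycle_flipCycle, flipCycle_involutive j σ]
  · by_cases h : σ.SameCycle i j
    · simp only [h, if_true, v, huo σ h, two_smul]
    · have huf : u (flipCycle j σ) = u σ := by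
        simp only [u, sameCycle_flipCycle, cycleRe_flipCycle hA]
      simp only [h, if_false, v, sameCycle_flipCycle, huf, sign_flipCycle]
      rw [rowCycleProd_flipCycle_of_sameCycle hA (Equiv.Perm.SameCycle.refl _ _),
        rowCycleProd_flipCycle_of_not_sameCycle B fun h' => h h'.symm, ← smul_add, ← add_mul,
        add_star_eq_two_smul_re, smul_mul_assoc, ← Algebra.smul_def, huo' σ h, smul_comm,
        ← mul_assoc, mul_smul _ (rowCycleProd A σ j).re]

end Swap

/-- The cycle product of `A` along the cycle of `σ` through `i`, without its first factor. -/
def rowCycleTail (A : Matrix (Fin n) (Fin n) SplitQuaternion) (σ : Equiv.Perm (Fin n))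
    (i : Fin n) : SplitQuaternion :=
  ((List.range (Function.minimalPeriod σ i - 1)).map
    (fun m => A ((σ ^ (m + 1)) i) ((σ ^ (m + 2)) i))).prod

lemma rowCycleProd_updateRow (A : Matrix (Fin n) (Fin n) SplitQuaternion)
    (σ : Equiv.Perm (Fin n)) (i : Fin n) (v : Fin n → SplitQuaternion) :
    rowCycleProd (A.updateRow i v) σ i = v (σ i) * rowCycleTail A σ i := by
  obtain ⟨L, hL⟩ := Nat.exists_eq_succ_of_ne_zero (minimalPeriod_perm_pos σ i).ne'
  rw [rowCycleProd, rowCycleTail, hL, Nat.succ_eq_add_one, List.range_succ_eq_map, List.map_cons,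
    List.prod_cons, List.map_map, Nat.add_sub_cancel]
  congr 1
  · simp
  · refine congrArg List.prod (List.map_congr_left fun m hm => ?_)
    rw [List.mem_range] at hm
    rw [Function.comp_apply, Matrix.updateRow_ne (pow_apply_ne_self (Nat.succ_pos m) (by omega))]

lemma rdet_updateRow {A : Matrix (Fin n) (Fin n) SplitQuaternion} (hA : A.IsHermitian)
    (i : Fin n) (v : Fin n → SplitQuaternion) :
    rdet (A.updateRow i v) i = ∑ σ : Equiv.Perm (Fin n),
      (((Equiv.Perm.sign σ : ℤ) : ℝ) * otherCyclesRe A i σ) • (v (σ i) * rowCycleTail A σ i) := by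
  rw [rdet_eq_sum_smul hA fun p q hp => by rw [Matrix.updateRow_ne hp]]
  simp only [rowCycleProd_updateRow]

lemma rdet_updateRow_add_linear_combination {A : Matrix (Fin n) (Fin n) SplitQuaternion}
    (hA : A.IsHermitian) {ι : Type*} [Fintype ι] (i : Fin n) (c : ι → SplitQuaternion)
    (v : Fin n → SplitQuaternion) (w : ι → Fin n → SplitQuaternion) :
    rdet (A.updateRow i (fun q => v q + ∑ l, c l * w l q)) i =
      rdet (A.updateRow i v) i + ∑ l, c l * rdet (A.updateRow i (w l)) i := by
  simp only [rdet_updateRow hA, add_mul, smul_add, Finset.sum_add_distrib, Finset.sum_mul,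
    Finset.mul_sum, Finset.smul_sum, mul_assoc, mul_smul_comm]
  rw [Finset.sum_comm]

/-- If to the `i`-th row of a Hermitian matrix `A` a left linear combination of its
other rows is added, then the `i`-th row determinant and the `i`-th column
determinant of the resulting matrix equal `det A`. -/
theorem rdet_cdet_updateRow_add_linear_combination [NeZero n]
    (A : Matrix (Fin n) (Fin n) SplitQuaternion) (hA : A.IsHermitian) (i : Fin n)
    (k : ℕ) (c : Fin k → SplitQuaternion) (idx : Fin k → Fin n)
    (hidx : ∀ l, idx l ≠ i) :
    rdet (A.updateRow i (fun q => A i q + ∑ l : Fin k, c l * A (idx l) q)) i = hdet A ∧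
    cdet (A.updateRow i (fun q => A i q + ∑ l : Fin k, c l * A (idx l) q)) i = hdet A := by
  have hrow : ∀ (v : Fin n → SplitQuaternion) (p q : Fin n), p ≠ i →
      A.updateRow i v p q = A p q := fun v p q hp => by rw [Matrix.updateRow_ne hp]
  have hr : rdet (A.updateRow i (fun q => A i q + ∑ l : Fin k, c l * A (idx l) q)) i = hdet A := by
    rw [rdet_updateRow_add_linear_combination hA i c (A i) fun l => A (idx l),
      Matrix.updateRow_eq_self, hdet_eq_rdet hA i, Finset.sum_eq_zero, add_zero]
    intro l _
    rw [rdet_eq_zero_of_row_eq hA (hrow _) (hidx l).symm fun q => by rw [Matrix.updateRow_self],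
      mul_zero]
  exact ⟨hr, (cdet_eq_rdet hA (hrow _)).trans hr⟩

end SplitQuaternion

end
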